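/- arXiv:2501.01364 — 4 statements merged into one kernel-verified Lean document; each statement's English description precedes it below -/
import Mathlib

section
/- Let ν > -1, n ∈ ℕ and y ∈ ℝ. The Dunkl translation of the monomial x^n satisfies τ_y((·)^n)(x) = Σ_{k=0}^n binom_ν(n,k) y^k x^{n−k} for all x ∈ ℝ, where binom_ν(n,k) = γ_{n,ν}/(γ_{k,ν}·γ_{n−k,ν}). -/
open Polynomial

noncomputable def gammaDunkl (ν : ℝ) (n : ℕ) : ℝ :=
  if Even n then 2 ^ n * (Nat.factorial (n / 2)) * (ascPochhammer ℝ (n / 2)).eval (ν + 1)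
  else 2 ^ n * (Nat.factorial (n / 2)) * (ascPochhammer ℝ (n / 2 + 1)).eval (ν + 1)

noncomputable def dunklOp (ν : ℝ) (p : Polynomial ℝ) : Polynomial ℝ :=
  derivative p + C ((2 * ν + 1) / 2) * (p - p.comp (-X)).divX

/-- Dunkl translation of a polynomial: `(τ_y p)(x) = Σ_n (Λ_ν^n p)(x) y^n / γ_{n,ν}`. -/
noncomputable def dunklTranslate (ν y : ℝ) (p : Polynomial ℝ) : Polynomial ℝ :=
  ∑ n ∈ Finset.range (p.natDegree + 1), C (y ^ n / gammaDunkl ν n) * (dunklOp ν)^[n] p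

noncomputable def binomDunkl (ν : ℝ) (n k : ℕ) : ℝ :=
  gammaDunkl ν n / (gammaDunkl ν k * gammaDunkl ν (n - k))

theorem gammaDunkl_pos {ν : ℝ} (hν : -1 < ν) (n : ℕ) : 0 < gammaDunkl ν n := by
  have h : ∀ k : ℕ, 0 < (ascPochhammer ℝ k).eval (ν + 1) :=
    fun k => ascPochhammer_pos k (ν + 1) (by linarith)
  unfold gammaDunkl
  split_ifs
  · have := h (n / 2)
    positivity
  · have := h (n / 2 + 1)
    positivity

theorem gammaDunkl_succ (ν : ℝ) (n : ℕ) :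
    gammaDunkl ν (n + 1)
      = (n + 1 + (2 * ν + 1) / 2 * (1 - (-1) ^ (n + 1))) * gammaDunkl ν n := by
  unfold gammaDunkl
  rcases Nat.even_or_odd' n with ⟨k, rfl | rfl⟩
  · have h : (2 * k + 1) / 2 = k := by lia
    have hk : 2 * k / 2 = k := by lia
    have he : ¬ Even (2 * k + 1) := by simp [parity_simps]
    rw [if_neg he, if_pos (even_two_mul k), h, hk, ascPochhammer_succ_eval, pow_succ (-1 : ℝ),
      (even_two_mul k).neg_one_pow]
    push_cast
    ring
  · have h : (2 * k + 1 + 1) / 2 = k + 1 := by lia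
    have hk : (2 * k + 1) / 2 = k := by lia
    have he : Even (2 * k + 1 + 1) := by simp [parity_simps]
    have ho : ¬ Even (2 * k + 1) := by simp [parity_simps]
    rw [if_pos he, if_neg ho, h, hk, he.neg_one_pow, Nat.factorial_succ]
    push_cast
    ring

theorem dunklOp_C_mul_X_pow_succ (ν a : ℝ) (n : ℕ) :
    dunklOp ν (C a * X ^ (n + 1))
      = C (a * (n + 1 + (2 * ν + 1) / 2 * (1 - (-1) ^ (n + 1)))) * X ^ n := by
  have h : C a * X ^ (n + 1) - (C a * X ^ (n + 1)).comp (-X)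
      = C (a * (1 - (-1) ^ (n + 1))) * X ^ (n + 1) := by
    rw [mul_comp, C_comp, X_pow_comp, neg_pow (X : ℝ[X])]
    simp only [map_mul, map_sub, map_pow, map_neg, map_one]
    ring
  rw [dunklOp, h, divX_C_mul, divX_X_pow, if_neg n.succ_ne_zero, derivative_C_mul_X_pow]
  simp only [Nat.add_sub_cancel, map_mul, map_sub, map_pow, map_neg, map_one, map_add,
    Nat.cast_add, Nat.cast_one]
  ring

theorem dunklOp_iterate_X_pow {ν : ℝ} (hν : -1 < ν) {n k : ℕ} (hk : k ≤ n) :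
    (dunklOp ν)^[k] (X ^ n) = C (gammaDunkl ν n / gammaDunkl ν (n - k)) * X ^ (n - k) := by
  induction k with
  | zero => simp [(gammaDunkl_pos hν n).ne']
  | succ k ih =>
    obtain ⟨m, rfl⟩ := Nat.exists_eq_add_of_le hk
    have h₁ : k + 1 + m - k = m + 1 := by lia
    have h₂ : k + 1 + m - (k + 1) = m := by lia
    rw [Function.iterate_succ_apply', ih (by lia), h₁, h₂, dunklOp_C_mul_X_pow_succ]
    congr 2
    have hm := (gammaDunkl_pos hν m).ne'
    have hm' := (gammaDunkl_pos hν (m + 1)).ne'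
    rw [div_mul_eq_mul_div, div_eq_div_iff hm' hm, gammaDunkl_succ ν m]
    ring

theorem dunklTranslate_monomial (ν : ℝ) (hν : -1 < ν) (n : ℕ) (y x : ℝ) :
    (dunklTranslate ν y (X ^ n)).eval x
      = ∑ k ∈ Finset.range (n + 1), binomDunkl ν n k * y ^ k * x ^ (n - k) := by
  rw [dunklTranslate, natDegree_X_pow, eval_finsetSum]
  refine Finset.sum_congr rfl fun k hk => ?_
  rw [dunklOp_iterate_X_pow hν (Finset.mem_range_succ_iff.mp hk), binomDunkl]
  simp only [eval_mul, eval_C, eval_pow, eval_X]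
  have h₁ := (gammaDunkl_pos hν k).ne'
  have h₂ := (gammaDunkl_pos hν (n - k)).ne'
  field_simp
end

section
/- Let ν > -1. For every real polynomial p, (ν+1)·(τ_1 p − τ_{−1} p) = Σ_{n≥0} (1/γ_{2n,ν+1}) Λ_ν^{2n+1} p (a finite sum). Equivalently, since γ_{2n+1,ν} = 2(ν+1)·γ_{2n,ν+1}, the operator L_{G_ν} built from the coefficients of the odd Dunkl kernel G_ν(t) = 2(ν+1) Σ_{n≥0} t^{2n+1}/γ_{2n+1,ν} equals (ν+1)(τ_1 − τ_{−1}). -/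
open Polynomial

/-- The operator `L_f p = Σ_{n≥1} (a_n/γ_{n,ν}) Λ_ν^n p` (a finite sum). -/
noncomputable def dunklLf (ν : ℝ) (a : ℕ → ℝ) (p : Polynomial ℝ) : Polynomial ℝ :=
  ∑ n ∈ Finset.Icc 1 p.natDegree, C (a n / gammaDunkl ν n) * (dunklOp ν)^[n] p

theorem gammaDunkl_two_mul_add_one (ν : ℝ) (n : ℕ) :
    gammaDunkl ν (2 * n + 1) = 2 * (ν + 1) * gammaDunkl (ν + 1) (2 * n) := by
  have h : (2 * n + 1) / 2 = n := by lia
  simp only [gammaDunkl, Nat.not_even_two_mul_add_one, even_two_mul, if_true, if_false, h,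
    Nat.mul_div_cancel_left n two_pos, ascPochhammer_succ_left, eval_mul, eval_comp, eval_add,
    eval_X, eval_one]
  ring

theorem coeff_dunklOp (ν : ℝ) (p : ℝ[X]) (k : ℕ) :
    (dunklOp ν p).coeff k =
      (k + 1 + (2 * ν + 1) / 2 * (1 - (-1) ^ (k + 1))) * p.coeff (k + 1) := by
  have h : (-X : ℝ[X]) = C (-1) * X := by simp
  simp only [dunklOp, h, coeff_add, coeff_derivative, coeff_C_mul, coeff_divX, coeff_sub,
    comp_C_mul_X_coeff]
  ring

theorem iterate_dunklOp_eq_zero (ν : ℝ) {p : ℝ[X]} {n : ℕ} (h : p.natDegree < n) :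
    (dunklOp ν)^[n] p = 0 := by
  have key (n : ℕ) : ∀ p : ℝ[X], (∀ k, n ≤ k → p.coeff k = 0) → (dunklOp ν)^[n] p = 0 := by
    induction n with
    | zero => exact fun p hp => Polynomial.ext fun k => by simpa using hp k k.zero_le
    | succ n ih =>
      intro p hp
      rw [Function.iterate_succ_apply]
      refine ih _ fun k hk => ?_
      rw [coeff_dunklOp, hp (k + 1) (by lia), mul_zero]
  exact key n p fun k hk => coeff_eq_zero_of_natDegree_lt (h.trans_le hk)

theorem sum_range_two_mul_eq_sum_odd {M : Type*} [AddCommMonoid M] {f : ℕ → M}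
    (hf : ∀ n, Even n → f n = 0) (m : ℕ) :
    ∑ n ∈ Finset.range (2 * m), f n = ∑ k ∈ Finset.range m, f (2 * k + 1) := by
  induction m with
  | zero => simp
  | succ m ih =>
    rw [mul_add_one, Finset.sum_range_succ, Finset.sum_range_succ, ih, hf _ (even_two_mul m),
      add_zero, Finset.sum_range_succ]

theorem dunklTranslate_one_sub_neg_one {ν : ℝ} (hν : -1 < ν) (p : ℝ[X]) :
    C (ν + 1) * (dunklTranslate ν 1 p - dunklTranslate ν (-1) p) =
      ∑ n ∈ Finset.range (p.natDegree + 1),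
        C (if Odd n then 1 / gammaDunkl (ν + 1) (n - 1) else 0) * (dunklOp ν)^[n] p := by
  rw [dunklTranslate, dunklTranslate, ← Finset.sum_sub_distrib, Finset.mul_sum]
  refine Finset.sum_congr rfl fun n _ => ?_
  rw [← sub_mul, ← C_sub, ← mul_assoc, ← C_mul]
  congr 2
  rcases Nat.even_or_odd n with hn | hn
  · simp [hn.neg_one_pow, Nat.not_odd_iff_even.mpr hn]
  · obtain ⟨k, rfl⟩ := hn
    have h₁ := (gammaDunkl_pos (ν := ν + 1) (by linarith) (2 * k)).ne'
    have h₂ : ν + 1 ≠ 0 := by linarith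
    rw [if_pos (odd_two_mul_add_one k), (odd_two_mul_add_one k).neg_one_pow, one_pow,
      Nat.add_sub_cancel, gammaDunkl_two_mul_add_one]
    field_simp
    ring

theorem discrete_operator_eq (ν : ℝ) (hν : -1 < ν) :
    (∀ p : Polynomial ℝ,
      C (ν + 1) * (dunklTranslate ν 1 p - dunklTranslate ν (-1) p)
        = ∑ n ∈ Finset.range (p.natDegree + 1),
            C (1 / gammaDunkl (ν + 1) (2 * n)) * (dunklOp ν)^[2 * n + 1] p) ∧
    (∀ n : ℕ, gammaDunkl ν (2 * n + 1) = 2 * (ν + 1) * gammaDunkl (ν + 1) (2 * n)) ∧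
    (∀ p : Polynomial ℝ,
      dunklLf ν (fun n => if Odd n then gammaDunkl ν n / gammaDunkl (ν + 1) (n - 1) else 0) p
        = C (ν + 1) * (dunklTranslate ν 1 p - dunklTranslate ν (-1) p)) := by
  refine ⟨fun p => ?_, gammaDunkl_two_mul_add_one ν, fun p => ?_⟩
  · rw [dunklTranslate_one_sub_neg_one hν]
    set f : ℕ → ℝ[X] := fun n =>
      C (if Odd n then 1 / gammaDunkl (ν + 1) (n - 1) else 0) * (dunklOp ν)^[n] p with hf
    have h_even (n : ℕ) (hn : Even n) : f n = 0 := by simp [hf, Nat.not_odd_iff_even.mpr hn]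
    have h_tail : ∀ n ∈ Finset.range (2 * (p.natDegree + 1)),
        n ∉ Finset.range (p.natDegree + 1) → f n = 0 := fun n _ hn => by
      rw [Finset.mem_range, not_lt] at hn
      simp only [hf, iterate_dunklOp_eq_zero ν hn, mul_zero]
    rw [Finset.sum_subset (Finset.range_mono (by lia : p.natDegree + 1 ≤ 2 * (p.natDegree + 1)))
      h_tail,
      sum_range_two_mul_eq_sum_odd h_even]
    simp [hf]
  · rw [dunklTranslate_one_sub_neg_one hν, dunklLf, Finset.range_eq_Ico,
      Finset.sum_eq_sum_Ico_succ_bot (Nat.succ_pos _)]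
    simp only [Nat.not_odd_zero, if_false, C_0, zero_mul, zero_add]
    refine Finset.sum_congr rfl fun n _ => ?_
    have h := (gammaDunkl_pos hν n).ne'
    congr 2
    split_ifs
    · field_simp
    · exact zero_div _
end

section
/- Let ν > -1 and let A_{n,ν}(x) = γ_{n,ν}·Σ_{k=0}^n x^k/γ_{k,ν} be the truncated Appell-Dunkl polynomials. Then for all integers 0 ≤ r ≤ n, (γ_{n,ν}/γ_{n−r,ν})·(A_{n−r,ν}(0) − γ_{1,ν}·A′_{n−r,ν}(0)) = γ_{n,ν}·δ_{n,r}, where A′ denotes the ordinary derivative; that is, the distribution α_ν = δ_0 + γ_{1,ν}·δ_0′ satisfies the Thorne-type biorthogonality ∫ Λ_ν^r A_{n,ν} dα_ν = γ_{n,ν} δ_{n,r}. -/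
open Polynomial

/-- The truncated Appell-Dunkl polynomials `A_{n,ν}(x) = γ_{n,ν} Σ_{k=0}^n x^k/γ_{k,ν}`. -/
noncomputable def truncatedAppellDunkl (ν : ℝ) (n : ℕ) : Polynomial ℝ :=
  C (gammaDunkl ν n) * ∑ k ∈ Finset.range (n + 1), C (1 / gammaDunkl ν k) * X ^ k

theorem gammaDunkl_zero (ν : ℝ) : gammaDunkl ν 0 = 1 := by
  simp [gammaDunkl]

theorem truncatedAppellDunkl_coeff (ν : ℝ) (n k : ℕ) :
    (truncatedAppellDunkl ν n).coeff k =
      if k ≤ n then gammaDunkl ν n / gammaDunkl ν k else 0 := by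
  simp [truncatedAppellDunkl, coeff_X_pow, div_eq_mul_inv]

/-- Thorne-type biorthogonality for the truncated Appell-Dunkl polynomials with
respect to the distribution `δ_0 + γ_{1,ν} δ_0'` (acting by `p ↦ p(0) − γ_{1,ν} p'(0)`). -/
theorem truncatedAppellDunkl_biorthogonal (ν : ℝ) (hν : -1 < ν) :
    ∀ n r : ℕ, r ≤ n →
      gammaDunkl ν n / gammaDunkl ν (n - r) *
          ((truncatedAppellDunkl ν (n - r)).eval 0
            - gammaDunkl ν 1 * (derivative (truncatedAppellDunkl ν (n - r))).eval 0)
        = gammaDunkl ν n * (if n = r then 1 else 0) := by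
  intro n r hr
  have hpos := gammaDunkl_pos hν
  rw [← coeff_zero_eq_eval_zero, ← coeff_zero_eq_eval_zero, coeff_derivative,
    truncatedAppellDunkl_coeff, truncatedAppellDunkl_coeff]
  rcases hr.eq_or_lt with rfl | hlt
  · simp [gammaDunkl_zero]
  · have h1 : 0 + 1 ≤ n - r := by omega
    have := (hpos 1).ne'
    rw [if_pos (Nat.zero_le _), if_pos h1, if_neg hlt.ne', gammaDunkl_zero]
    field_simp
    simp
end

section
/- Let ν > -1 and let A_{n,ν}(x) = γ_{n,ν}·Σ_{k=0}^{⌊n/2⌋} x^{n−2k}/γ_{n−2k,ν}. Then for all integers 0 ≤ r ≤ n, (γ_{n,ν}/γ_{n−r,ν})·(A_{n−r,ν}(0) − (γ_{2,ν}/2)·A″_{n−r,ν}(0)) = γ_{n,ν}·δ_{n,r}, where A″ denotes the second ordinary derivative. -/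
open Polynomial

/-- The Appell-Dunkl polynomials `A_{n,ν}(x) = γ_{n,ν} Σ_{k=0}^{⌊n/2⌋} x^{n-2k}/γ_{n-2k,ν}`. -/
noncomputable def evenTruncatedAppellDunkl (ν : ℝ) (n : ℕ) : Polynomial ℝ :=
  C (gammaDunkl ν n) *
    ∑ k ∈ Finset.range (n / 2 + 1), C (1 / gammaDunkl ν (n - 2 * k)) * X ^ (n - 2 * k)

theorem gammaDunkl_two (ν : ℝ) : gammaDunkl ν 2 = 4 * (ν + 1) := by
  norm_num [gammaDunkl]

theorem coeff_evenTruncatedAppellDunkl (ν : ℝ) (n j : ℕ) :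
    (evenTruncatedAppellDunkl ν n).coeff j =
      if j ≤ n ∧ Even (n - j) then gammaDunkl ν n / gammaDunkl ν j else 0 := by
  simp only [evenTruncatedAppellDunkl, coeff_C_mul, finsetSum_coeff, coeff_X_pow]
  split_ifs with h
  · obtain ⟨hj, k, hk⟩ := h
    rw [Finset.sum_eq_single k]
    · have hnk : n - 2 * k = j := by omega
      simp [hnk, div_eq_mul_inv]
    · intro b hb hbk
      rw [Finset.mem_range] at hb
      rw [if_neg (by omega), mul_zero]
    · intro hk'
      rw [Finset.mem_range] at hk'
      omega
  · rw [Finset.sum_eq_zero, mul_zero]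
    intro k hk
    rw [Finset.mem_range] at hk
    rw [if_neg, mul_zero]
    intro hj
    exact h ⟨by omega, k, by omega⟩

theorem eval_zero_derivative_derivative {R : Type*} [CommSemiring R] (p : R[X]) :
    (derivative (derivative p)).eval 0 = 2 * p.coeff 2 := by
  rw [← coeff_zero_eq_eval_zero, coeff_derivative, coeff_derivative]
  norm_num [mul_comm]

/-- Thorne-type biorthogonality with respect to `δ_0 − (γ_{2,ν}/2) δ_0''`
(acting by `p ↦ p(0) − (γ_{2,ν}/2) p''(0)`). -/
theorem evenTruncatedAppellDunkl_biorthogonal (ν : ℝ) (hν : -1 < ν) :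
    ∀ n r : ℕ, r ≤ n →
      gammaDunkl ν n / gammaDunkl ν (n - r) *
          ((evenTruncatedAppellDunkl ν (n - r)).eval 0
            - gammaDunkl ν 2 / 2 *
              (derivative (derivative (evenTruncatedAppellDunkl ν (n - r)))).eval 0)
        = gammaDunkl ν n * (if n = r then 1 else 0) := by
  intro n r hrn
  have hγ : gammaDunkl ν 2 ≠ 0 := by
    rw [gammaDunkl_two]
    exact mul_ne_zero four_ne_zero (by linarith)
  rw [← coeff_zero_eq_eval_zero, eval_zero_derivative_derivative,
    coeff_evenTruncatedAppellDunkl, coeff_evenTruncatedAppellDunkl, gammaDunkl_zero]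
  obtain rfl | hne := eq_or_ne n r
  · simp [gammaDunkl_zero]
  · rw [if_neg hne, mul_zero]
    by_cases hm : Even (n - r)
    · have h2 : 2 ≤ n - r := by
        obtain ⟨k, hk⟩ := hm
        omega
      rw [if_pos ⟨Nat.zero_le _, hm⟩, if_pos ⟨h2, (Nat.even_sub h2).2 (by simp [hm])⟩]
      field_simp
      ring
    · rw [if_neg (by simpa using hm), if_neg]
      · simp
      · rintro ⟨h2, he⟩
        exact hm (by simpa using (Nat.even_sub h2).1 he)
end
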